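/- For any real T ≥ 1 and modulus q ≥ 3, the number of nontrivial zeros ρ of a Dirichlet L-function L(s,χ) (χ a character mod q) with |Im ρ| ≤ T is O(T log(qT)). -/

import Mathlib

section

open Complex Filter Topology MeasureTheory Asymptotics

/-- The integral `∫ t in Ioi 1, S(t) t ^ (-(s + 1))` depends holomorphically on `s` in the right
half-plane when `S` is a bounded function. -/
lemma differentiableAt_integral_Ioi_mul_cpow {S : ℝ → ℂ} {B : ℝ} (hm : Measurable S)
    (hS : ∀ t, ‖S t‖ ≤ B) {s : ℂ} (hs : 0 < s.re) :
    DifferentiableAt ℂ (fun s : ℂ ↦ ∫ t in Set.Ioi (1 : ℝ), S t * t ^ (-(s + 1))) s := by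
  let f : ℝ → ℂ := Set.indicator (Set.Ioi 1) S
  have hfB t : ‖f t‖ ≤ B := (norm_indicator_le_norm_self _ _).trans (hS t)
  have heq : (fun s : ℂ ↦ ∫ t in Set.Ioi (1 : ℝ), S t * t ^ (-(s + 1))) =
      fun s ↦ mellin f (-s) := by
    ext s
    have : ∀ t : ℝ, (t : ℂ) ^ (-s - 1) • f t =
        Set.indicator (Set.Ioi 1) (fun t : ℝ ↦ S t * t ^ (-(s + 1))) t := by
      intro t
      by_cases ht : t ∈ Set.Ioi (1 : ℝ)
      · simp only [f, Set.indicator_of_mem ht, smul_eq_mul]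
        rw [mul_comm, neg_add']
      · simp [f, Set.indicator_of_notMem ht]
    simp only [mellin, this]
    rw [setIntegral_indicator measurableSet_Ioi, Set.Ioi_inter_Ioi]
    simp
  rw [heq]
  refine DifferentiableAt.comp (g := mellin f) s ?_ differentiableAt_id.neg
  refine mellin_differentiableAt_of_isBigO_rpow (a := 0) (b := -s.re - 1) ?_ ?_ (by simpa) ?_
    (by simp)
  · refine LocallyIntegrable.locallyIntegrableOn ?_ _
    refine (locallyIntegrable_const B).mono (hm.indicator measurableSet_Ioi).aestronglyMeasurable
      (.of_forall fun t ↦ (hfB t).trans (le_abs_self B))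
  · refine IsBigO.of_bound B (.of_forall fun t ↦ ?_)
    simpa using hfB t
  · refine IsBigO.of_bound 0 ?_
    filter_upwards [nhdsWithin_le_nhds (Iio_mem_nhds one_pos)] with t ht
    simp [f, Set.indicator_of_notMem (Set.notMem_Ioi.mpr (Set.mem_Iio.mp ht).le)]

namespace ZMod

variable {N : ℕ} [NeZero N]

lemma sum_range_natCast_add {M : Type*} [AddCommMonoid M] (Φ : ZMod N → M) (a : ℕ) :
    ∑ i ∈ Finset.range N, Φ ((a + i : ℕ) : ZMod N) = ∑ j, Φ j := by
  rw [← Equiv.sum_comp (Equiv.addLeft (a : ZMod N)) Φ]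
  refine Finset.sum_nbij' (fun i ↦ (i : ZMod N)) ZMod.val (by simp) (by simp [ZMod.val_lt]) ?_
    (by simp) (by simp)
  intro i hi
  exact ZMod.val_cast_of_lt (Finset.mem_range.mp hi)

lemma norm_sum_Icc_le_of_sum_eq_zero {Φ : ZMod N → ℂ} (hΦ : ∀ j, ‖Φ j‖ ≤ 1)
    (hsum : ∑ j, Φ j = 0) (n : ℕ) : ‖∑ k ∈ Finset.Icc 1 n, Φ k‖ ≤ N := by
  induction n using Nat.strong_induction_on with
  | _ n ih =>
    rcases lt_or_ge n N with h | h
    · calc ‖∑ k ∈ Finset.Icc 1 n, Φ k‖ ≤ ∑ k ∈ Finset.Icc 1 n, ‖Φ k‖ := norm_sum_le _ _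
        _ ≤ ∑ k ∈ Finset.Icc 1 n, (1 : ℝ) := Finset.sum_le_sum fun k _ ↦ hΦ k
        _ ≤ N := by simpa using h.le
    · obtain ⟨m, rfl⟩ := Nat.exists_eq_add_of_le' h
      have hs : ∑ k ∈ Finset.Icc 1 (m + N), Φ k = ∑ k ∈ Finset.Icc 1 m, Φ k := by
        simp only [← Finset.Ico_add_one_right_eq_Icc,
          Finset.sum_Ico_eq_sum_range, Nat.add_sub_cancel]
        rw [Finset.sum_range_add, add_eq_left, ← hsum, ← sum_range_natCast_add Φ (1 + m)]
        simp only [add_assoc]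
      rw [hs]
      exact ih m (by have := NeZero.pos N; omega)

lemma LFunction_eq_mul_integral {Φ : ZMod N → ℂ} (hΦ : ∀ j, ‖Φ j‖ ≤ 1)
    (hsum : ∑ j, Φ j = 0) {s : ℂ} (hs : 0 < s.re) :
    LFunction Φ s = s * ∫ t in Set.Ioi (1 : ℝ),
      (∑ k ∈ Finset.Icc 1 ⌊t⌋₊, Φ k) * t ^ (-(s + 1)) := by
  have hU : IsOpen {s : ℂ | 0 < s.re} := isOpen_lt continuous_const continuous_re
  have hm : Measurable fun t : ℝ ↦ ∑ k ∈ Finset.Icc 1 ⌊t⌋₊, Φ k :=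
    (measurable_from_nat (f := fun n ↦ ∑ k ∈ Finset.Icc 1 n, Φ k)).comp Nat.measurable_floor
  refine AnalyticOnNhd.eqOn_of_preconnected_of_eventuallyEq (z₀ := 2)
    (f := LFunction Φ) (g := fun s ↦ s * ∫ t in Set.Ioi (1 : ℝ),
      (∑ k ∈ Finset.Icc 1 ⌊t⌋₊, Φ k) * t ^ (-(s + 1)))
    ((differentiable_LFunction_of_sum_zero hsum).differentiableOn.analyticOnNhd hU)
    (DifferentiableOn.analyticOnNhd (fun z hz ↦ ?_) hU)
    (convex_halfSpace_re_gt 0).isPreconnected (by simp) ?_ hs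
  · exact (differentiableAt_id.mul (differentiableAt_integral_Ioi_mul_cpow hm
      (fun t ↦ norm_sum_Icc_le_of_sum_eq_zero hΦ hsum _) hz)).differentiableWithinAt
  · filter_upwards [(isOpen_lt continuous_const continuous_re).mem_nhds
      (show (1 : ℝ) < (2 : ℂ).re by simp)] with z hz
    rw [LFunction_eq_LSeries Φ hz]
    refine LSeries_eq_mul_integral _ le_rfl (zero_lt_one.trans hz)
      (LSeriesSummable_of_one_lt_re Φ hz) (IsBigO.of_bound N (.of_forall fun n ↦ ?_))
    simpa using norm_sum_Icc_le_of_sum_eq_zero hΦ hsum n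

lemma norm_LFunction_le {Φ : ZMod N → ℂ} (hΦ : ∀ j, ‖Φ j‖ ≤ 1)
    (hsum : ∑ j, Φ j = 0) {s : ℂ} (hs : 0 < s.re) :
    ‖LFunction Φ s‖ ≤ ‖s‖ * (N / s.re) := by
  rw [LFunction_eq_mul_integral hΦ hsum hs, norm_mul]
  gcongr
  have hlt : -(s.re + 1) < -1 := by linarith
  have hint : IntegrableOn (fun t : ℝ ↦ (N : ℝ) * t ^ (-(s.re + 1))) (Set.Ioi 1) :=
    (integrableOn_Ioi_rpow_of_lt hlt one_pos).const_mul _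
  calc _ ≤ ∫ t in Set.Ioi (1 : ℝ), (N : ℝ) * t ^ (-(s.re + 1)) := by
        refine norm_integral_le_of_norm_le hint ?_
        refine (ae_restrict_iff' measurableSet_Ioi).mpr (.of_forall fun t ht ↦ ?_)
        rw [norm_mul, norm_cpow_eq_rpow_re_of_pos (zero_lt_one.trans ht)]
        simpa using mul_le_mul_of_nonneg_right (norm_sum_Icc_le_of_sum_eq_zero hΦ hsum _)
          (Real.rpow_nonneg (zero_lt_one.trans ht).le _)
    _ = N / s.re := by
        rw [integral_const_mul, integral_Ioi_rpow_of_lt hlt one_pos]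
        simp [div_eq_mul_inv]

lemma one_third_le_norm_LFunction {Φ : ZMod N → ℂ} (hΦ : ∀ j, ‖Φ j‖ ≤ 1) (h1 : Φ 1 = 1)
    {s : ℂ} (hs : s.re = 2) : 1 / 3 ≤ ‖LFunction Φ s‖ := by
  have hs1 : 1 < s.re := by rw [hs]; norm_num
  have hsum := (LSeriesSummable_of_one_lt_re Φ hs1).hasSum
  rw [LFunction_eq_LSeries Φ hs1, LSeries]
  have hz := hasSum_zeta_two
  have h1' : LSeries.term (Φ ·) s 1 = 1 := by simp [h1]
  have hA := hsum.update 1 0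
  have hB := hz.update 1 0
  have hle := hA.norm_le_of_bounded hB fun n ↦ ?_
  · have hpi : Real.pi ^ 2 / 6 ≤ 5 / 3 := by
      nlinarith [Real.pi_lt_d2, Real.pi_pos]
    have htri := norm_sub_norm_le (1 : ℂ) (1 - ∑' n, LSeries.term (Φ ·) s n)
    simp only [h1', Nat.cast_one] at hle
    rw [norm_one, sub_sub_cancel, norm_sub_rev] at htri
    rw [zero_sub, neg_add_eq_sub] at hle
    norm_num at hle
    linarith
  · rcases eq_or_ne n 1 with rfl | hn
    · simp
    · rw [Function.update_of_ne hn, Function.update_of_ne hn]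
      rcases eq_or_ne n 0 with rfl | h0
      · simp
      · rw [LSeries.norm_term_eq, if_neg h0, hs]
        norm_num
        rw [div_eq_mul_inv]
        exact mul_le_of_le_one_left (by positivity) (hΦ _)

end ZMod

open Metric in
/-- A bound for the number of zeros in a disc, from Jensen's inequality. -/
lemma AnalyticOnNhd.finite_zeros_closedBall_and_ncard_le {c : ℂ} {r R M : ℝ} {f : ℂ → ℂ}
    (hr : 0 < r) (hrR : r < R) (hM : 1 ≤ M) (hf : AnalyticOnNhd ℂ f (closedBall c R))
    (hc : f c ≠ 0) (hb : ∀ z ∈ sphere c R, ‖f z‖ ≤ M) :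
    {z ∈ closedBall c r | f z = 0}.Finite ∧
      ({z ∈ closedBall c r | f z = 0}.ncard : ℝ) ≤ Real.log (M / ‖f c‖) / Real.log (R / r) := by
  have hR : 0 < R := hr.trans hrR
  have hfr : AnalyticOnNhd ℂ f (closedBall c r) := hf.mono (closedBall_subset_closedBall hrR.le)
  set D := MeromorphicOn.divisor f (closedBall c r) with hD
  have hfin : D.support.Finite := D.finiteSupport (isCompact_closedBall ..)
  have hpos : ∀ z ∈ {z ∈ closedBall c r | f z = 0}, 1 ≤ D z := by
    rintro z ⟨hz, hz0⟩
    have htop : analyticOrderAt f z ≠ ⊤ := by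
      intro h
      have := hfr.eqOn_zero_of_preconnected_of_eventuallyEq_zero
        (convex_closedBall c r).isPreconnected hz (analyticOrderAt_eq_top.mp h)
      exact hc (this (mem_closedBall_self hr.le))
    have hne : analyticOrderAt f z ≠ 0 := fun h ↦ ((hfr z hz).analyticOrderAt_eq_zero.mp h) hz0
    rw [hD, MeromorphicOn.AnalyticOnNhd.divisor_apply hfr hz]
    lift analyticOrderAt f z to ℕ using htop with n hn
    have : n ≠ 0 := by simpa using hne
    simp
    omega
  have hsub : {z ∈ closedBall c r | f z = 0} ⊆ D.support := fun z hz ↦ by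
    have := hpos z hz
    simp only [Function.mem_support]
    omega
  have hZ := hfin.subset hsub
  refine ⟨hZ, ?_⟩
  have h := AnalyticOnNhd.sum_divisor_le (c := c) (r := r) (R := R) (M := M) (f := f)
    (by simpa using hr.ne') (by simpa [abs_of_pos hr, abs_of_pos hR]) hM
    (by rwa [abs_of_pos hR]) hc (by rwa [abs_of_pos hR])
  rw [abs_of_pos hr, ← hD] at h
  refine le_trans ?_ h
  rw [Set.ncard_eq_toFinset_card _ hZ, finsum_eq_sum_of_support_subset (s := hfin.toFinset) _
    (by simp)]
  have : (hZ.toFinset.card : ℤ) ≤ ∑ z ∈ hfin.toFinset, D z := by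
    calc (hZ.toFinset.card : ℤ) = ∑ z ∈ hZ.toFinset, 1 := by simp
      _ ≤ ∑ z ∈ hZ.toFinset, D z :=
        Finset.sum_le_sum fun z hz ↦ hpos z (hZ.mem_toFinset.mp hz)
      _ ≤ ∑ z ∈ hfin.toFinset, D z := by
        refine Finset.sum_le_sum_of_subset_of_nonneg (Set.Finite.toFinset_subset_toFinset.mpr hsub)
          fun z _ _ ↦ MeromorphicOn.AnalyticOnNhd.divisor_nonneg hfr z
  exact_mod_cast this

namespace ZMod

variable {N : ℕ} [NeZero N]

lemma finite_zeros_LFunction_closedBall_and_ncard_le {Φ : ZMod N → ℂ} (hΦ : ∀ j, ‖Φ j‖ ≤ 1)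
    (h1 : Φ 1 = 1) (hsum : ∑ j, Φ j = 0) {q : ℕ} (hq : 3 ≤ q) (hNq : N ≤ q) {T t : ℝ}
    (hT : 1 ≤ T) (ht : |t| ≤ T + 1) :
    {z ∈ Metric.closedBall (2 + t * I) (8 / 5) | LFunction Φ z = 0}.Finite ∧
      ({z ∈ Metric.closedBall (2 + t * I) (8 / 5) | LFunction Φ z = 0}.ncard : ℝ) ≤
        5 / Real.log (35 / 32) * Real.log (q * T) := by
  set c : ℂ := 2 + t * I with hc
  have hcre : c.re = 2 := by simp [hc]
  have hcnorm : ‖c‖ ≤ 2 + |t| := by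
    refine (norm_add_le _ _).trans ?_
    simp
  have hL : 1 / 3 ≤ ‖LFunction Φ c‖ := one_third_le_norm_LFunction hΦ h1 hcre
  have hL0 : LFunction Φ c ≠ 0 := norm_pos_iff.mp (lt_of_lt_of_le (by norm_num) hL)
  have hN1 : (1 : ℝ) ≤ N := by exact_mod_cast NeZero.one_le
  have hNq' : (N : ℝ) ≤ q := by exact_mod_cast hNq
  have hq' : (3 : ℝ) ≤ q := by exact_mod_cast hq
  have h := AnalyticOnNhd.finite_zeros_closedBall_and_ncard_le (c := c) (r := 8 / 5) (R := 7 / 4)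
    (M := (|t| + 4) * (4 * N)) (f := LFunction Φ) (by norm_num) (by norm_num)
    (by nlinarith [abs_nonneg t])
    (fun z _ ↦ (differentiable_LFunction_of_sum_zero hsum).analyticAt z) hL0 ?_
  · refine ⟨h.1, h.2.trans ?_⟩
    have h35 : (7 / 4 : ℝ) / (8 / 5) = 35 / 32 := by norm_num
    have hqT : 3 ≤ q * T := by nlinarith
    rw [h35, div_mul_eq_mul_div]
    have : 0 < Real.log (35 / 32) := Real.log_pos (by norm_num)
    gcongr
    rw [show (5 : ℝ) = (5 : ℕ) by norm_num, ← Real.log_pow]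
    refine Real.log_le_log (by positivity) ?_
    calc (|t| + 4) * (4 * N) / ‖LFunction Φ c‖ ≤ (T + 1 + 4) * (4 * q) / (1 / 3) := by gcongr
      _ ≤ 3 ^ 4 * (q * T) := by nlinarith
      _ ≤ (q * T) ^ 4 * (q * T) := by gcongr
      _ = (q * T) ^ 5 := by ring
  · intro z hz
    have hz' : ‖z - c‖ = 7 / 4 := by simpa [dist_eq_norm] using hz
    have hre : 1 / 4 ≤ z.re := by
      have := (abs_le.mp ((abs_re_le_norm (z - c)).trans_eq hz')).1
      rw [sub_re, hcre] at this
      linarith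
    have hzn : ‖z‖ ≤ |t| + 4 := by
      have := norm_le_norm_add_norm_sub' z c
      linarith
    refine (norm_LFunction_le hΦ hsum (by linarith)).trans ?_
    gcongr
    rw [div_le_iff₀ (by linarith)]
    nlinarith

lemma finite_zeros_LFunction_and_ncard_le {Φ : ZMod N → ℂ} (hΦ : ∀ j, ‖Φ j‖ ≤ 1)
    (h1 : Φ 1 = 1) (hsum : ∑ j, Φ j = 0) {q : ℕ} (hq : 3 ≤ q) (hNq : N ≤ q) {T : ℝ}
    (hT : 1 ≤ T) :
    {ρ : ℂ | 1 / 2 ≤ ρ.re ∧ ρ.re < 1 ∧ |ρ.im| ≤ T ∧ LFunction Φ ρ = 0}.Finite ∧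
      ({ρ : ℂ | 1 / 2 ≤ ρ.re ∧ ρ.re < 1 ∧ |ρ.im| ≤ T ∧ LFunction Φ ρ = 0}.ncard : ℝ) ≤
        25 / Real.log (35 / 32) * T * Real.log (q * T) := by
  let Z : ℤ → Set ℂ := fun n ↦
    {z ∈ Metric.closedBall (2 + (n : ℝ) * I) (8 / 5) | LFunction Φ z = 0}
  have hZ : ∀ n ∈ Finset.Icc (-⌈T⌉) ⌈T⌉, (Z n).Finite ∧
      ((Z n).ncard : ℝ) ≤ 5 / Real.log (35 / 32) * Real.log (q * T) := fun n hn ↦ by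
    refine finite_zeros_LFunction_closedBall_and_ncard_le hΦ h1 hsum hq hNq hT ?_
    rw [Finset.mem_Icc, ← abs_le] at hn
    have hn' : |(n : ℝ)| ≤ ⌈T⌉ := by exact_mod_cast hn
    exact hn'.trans (Int.ceil_lt_add_one T).le
  have hsub : {ρ : ℂ | 1 / 2 ≤ ρ.re ∧ ρ.re < 1 ∧ |ρ.im| ≤ T ∧ LFunction Φ ρ = 0} ⊆
      ⋃ n ∈ Finset.Icc (-⌈T⌉) ⌈T⌉, Z n := by
    rintro ρ ⟨hre, hre1, him, h0⟩
    have hr := abs_le.mp (abs_sub_round ρ.im)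
    have hi := abs_le.mp him
    have hceil := Int.le_ceil T
    simp only [Set.mem_iUnion]
    refine ⟨round ρ.im, Finset.mem_Icc.mpr ⟨?_, ?_⟩, ?_, h0⟩
    · have : (-⌈T⌉ : ℝ) - 1 < round ρ.im := by linarith
      have : -⌈T⌉ - 1 < round ρ.im := by exact_mod_cast this
      omega
    · have : (round ρ.im : ℝ) < ⌈T⌉ + 1 := by linarith
      have : round ρ.im < ⌈T⌉ + 1 := by exact_mod_cast this
      omega
    · rw [Metric.mem_closedBall, dist_eq_norm]
      refine abs_le_of_sq_le_sq' ?_ (by norm_num) |>.2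
      rw [Complex.sq_norm, normSq_apply]
      simp
      nlinarith
  have hfin : (⋃ n ∈ Finset.Icc (-⌈T⌉) ⌈T⌉, Z n).Finite :=
    (Finset.finite_toSet _).biUnion fun n hn ↦ (hZ n hn).1
  refine ⟨hfin.subset hsub, ?_⟩
  have hlog : 0 < Real.log (35 / 32) := Real.log_pos (by norm_num)
  have hq' : (3 : ℝ) ≤ q := by exact_mod_cast hq
  have hlog' : 0 ≤ Real.log (q * T) := Real.log_nonneg (by nlinarith)
  have hceil1 : (1 : ℤ) ≤ ⌈T⌉ := Int.one_le_ceil_iff.mpr (by linarith)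
  have hcard : ((Finset.Icc (-⌈T⌉) ⌈T⌉).card : ℝ) ≤ 5 * T := by
    have h : ((Finset.Icc (-⌈T⌉) ⌈T⌉).card : ℤ) = 2 * ⌈T⌉ + 1 := by
      rw [Int.card_Icc]
      omega
    have h' : ((Finset.Icc (-⌈T⌉) ⌈T⌉).card : ℝ) = 2 * ⌈T⌉ + 1 := by exact_mod_cast h
    linarith [Int.ceil_lt_add_one T]
  calc _ ≤ ((⋃ n ∈ Finset.Icc (-⌈T⌉) ⌈T⌉, Z n).ncard : ℝ) := by
        exact_mod_cast Set.ncard_le_ncard hsub hfin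
    _ ≤ ∑ n ∈ Finset.Icc (-⌈T⌉) ⌈T⌉, ((Z n).ncard : ℝ) := by
        exact_mod_cast Finset.set_ncard_biUnion_le _ _
    _ ≤ ∑ n ∈ Finset.Icc (-⌈T⌉) ⌈T⌉, 5 / Real.log (35 / 32) * Real.log (q * T) :=
        Finset.sum_le_sum fun n hn ↦ (hZ n hn).2
    _ ≤ 5 * T * (5 / Real.log (35 / 32) * Real.log (q * T)) := by
        rw [Finset.sum_const, nsmul_eq_mul]
        gcongr
    _ = _ := by ring

lemma sum_univ_two {M : Type*} [AddCommMonoid M] (f : ZMod 2 → M) : ∑ j, f j = f 0 + f 1 :=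
  Fin.sum_univ_two f

/-- The alternating zeta function as the L-function of a function on `ZMod 2`. -/
lemma LFunction_alternating_eq_mul_riemannZeta {s : ℂ} (hs : s ≠ 1) :
    LFunction (fun j : ZMod 2 ↦ if j = 0 then -1 else 1) s =
      (1 - 2 * 2 ^ (-s)) * riemannZeta s := by
  have h := DirichletCharacter.LFunctionTrivChar_eq_mul_riemannZeta (N := 2) hs
  have h0 : (1 : DirichletCharacter ℂ 2) 0 = 0 := MulChar.map_zero _
  have h1 : (1 : DirichletCharacter ℂ 2) 1 = 1 := map_one _
  rw [DirichletCharacter.LFunctionTrivChar, DirichletCharacter.LFunction, LFunction, sum_univ_two, h0, h1,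
    Nat.prime_two.primeFactors, Finset.prod_singleton] at h
  rw [LFunction, sum_univ_two, map_zero, HurwitzZeta.hurwitzZeta_zero]
  push_cast at h ⊢
  simp only [one_ne_zero, if_true, if_false]
  linear_combination h

end ZMod

namespace DirichletCharacter

lemma finite_zeros_LFunction_right_and_ncard_le {N : ℕ} [NeZero N] {χ : DirichletCharacter ℂ N}
    (hχ : χ.IsPrimitive) {q : ℕ} (hq : 3 ≤ q) (hNq : N ≤ q) {T : ℝ} (hT : 1 ≤ T) :
    {ρ : ℂ | 1 / 2 ≤ ρ.re ∧ ρ.re < 1 ∧ |ρ.im| ≤ T ∧ LFunction χ ρ = 0}.Finite ∧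
      ({ρ : ℂ | 1 / 2 ≤ ρ.re ∧ ρ.re < 1 ∧ |ρ.im| ≤ T ∧ LFunction χ ρ = 0}.ncard : ℝ) ≤
        25 / Real.log (35 / 32) * T * Real.log (q * T) := by
  by_cases h : χ = 1
  · have hN : N = 1 := by rw [← (isPrimitive_def χ).mp hχ, eq_one_iff_conductor_eq_one.mp h]
    subst hN
    have := ZMod.finite_zeros_LFunction_and_ncard_le (N := 2)
      (Φ := fun j : ZMod 2 ↦ if j = 0 then -1 else 1) (fun j ↦ by split_ifs <;> simp) (by simp)
      (by rw [ZMod.sum_univ_two]; simp) hq (by omega) hT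
    have hsub : {ρ : ℂ | 1 / 2 ≤ ρ.re ∧ ρ.re < 1 ∧ |ρ.im| ≤ T ∧ LFunction χ ρ = 0} ⊆
        {ρ : ℂ | 1 / 2 ≤ ρ.re ∧ ρ.re < 1 ∧ |ρ.im| ≤ T ∧
          ZMod.LFunction (fun j : ZMod 2 ↦ if j = 0 then -1 else 1) ρ = 0} := by
      rintro ρ ⟨h1, h2, h3, h4⟩
      refine ⟨h1, h2, h3, ?_⟩
      rw [ZMod.LFunction_alternating_eq_mul_riemannZeta (by rintro rfl; simp at h2)]
      rw [LFunction_modOne_eq] at h4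
      rw [h4, mul_zero]
    exact ⟨this.1.subset hsub, le_trans (by exact_mod_cast Set.ncard_le_ncard hsub this.1) this.2⟩
  · exact ZMod.finite_zeros_LFunction_and_ncard_le (Φ := χ) χ.norm_le_one (map_one χ)
      (χ.sum_eq_zero_of_ne_one h) hq hNq hT

lemma IsPrimitive.LFunction_inv_one_sub_eq_zero {N : ℕ} [NeZero N] {χ : DirichletCharacter ℂ N}
    (hχ : χ.IsPrimitive) {s : ℂ} (h0 : 0 < s.re) (h1 : s.re < 1) (hs : LFunction χ s = 0) :
    LFunction χ⁻¹ (1 - s) = 0 := by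
  have hs0 : s ≠ 0 := by rintro rfl; simp at h0
  have hs1 : 1 - s ≠ 0 := fun h ↦ by
    rw [← sub_eq_zero.mp h] at h1
    simp at h1
  have hγ : gammaFactor χ s ≠ 0 := by
    unfold gammaFactor
    split_ifs
    · exact Gammaℝ_ne_zero_of_re_pos h0
    · exact Gammaℝ_ne_zero_of_re_pos (by simp; linarith)
  have hc : completedLFunction χ s = 0 := by
    rw [LFunction_eq_completed_div_gammaFactor χ s (.inl hs0)] at hs
    exact (div_eq_zero_iff.mp hs).resolve_right hγ
  have hinv : χ⁻¹.IsPrimitive := by rw [isPrimitive_def, conductor_inv, hχ]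
  rw [LFunction_eq_completed_div_gammaFactor _ _ (.inl hs1), hinv.completedLFunction_one_sub,
    inv_inv, hc, mul_zero, zero_div]

lemma IsPrimitive.finite_zeros_LFunction_and_ncard_le {N : ℕ} [NeZero N]
    {χ : DirichletCharacter ℂ N} (hχ : χ.IsPrimitive) {q : ℕ} (hq : 3 ≤ q) (hNq : N ≤ q) {T : ℝ}
    (hT : 1 ≤ T) :
    {ρ : ℂ | 0 < ρ.re ∧ ρ.re < 1 ∧ |ρ.im| ≤ T ∧ LFunction χ ρ = 0}.Finite ∧
      ({ρ : ℂ | 0 < ρ.re ∧ ρ.re < 1 ∧ |ρ.im| ≤ T ∧ LFunction χ ρ = 0}.ncard : ℝ) ≤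
        50 / Real.log (35 / 32) * T * Real.log (q * T) := by
  have hinv : χ⁻¹.IsPrimitive := by rw [isPrimitive_def, conductor_inv, hχ]
  obtain ⟨hf, hn⟩ := finite_zeros_LFunction_right_and_ncard_le hχ hq hNq hT
  obtain ⟨hf', hn'⟩ := finite_zeros_LFunction_right_and_ncard_le hinv hq hNq hT
  set A := {ρ : ℂ | 1 / 2 ≤ ρ.re ∧ ρ.re < 1 ∧ |ρ.im| ≤ T ∧ LFunction χ ρ = 0}
  set B := {ρ : ℂ | 1 / 2 ≤ ρ.re ∧ ρ.re < 1 ∧ |ρ.im| ≤ T ∧ LFunction χ⁻¹ ρ = 0}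
  have hsub : {ρ : ℂ | 0 < ρ.re ∧ ρ.re < 1 ∧ |ρ.im| ≤ T ∧ LFunction χ ρ = 0} ⊆
      A ∪ (1 - ·) '' B := by
    rintro ρ ⟨h1, h2, h3, h4⟩
    rcases le_or_gt (1 / 2) ρ.re with h | h
    · exact .inl ⟨h, h2, h3, h4⟩
    · refine .inr ⟨1 - ρ, ⟨?_, ?_, ?_, hχ.LFunction_inv_one_sub_eq_zero h1 h2 h4⟩, by simp⟩
      · simp only [sub_re, one_re]; linarith
      · simpa
      · simpa
  have hfin : (A ∪ (1 - ·) '' B).Finite := hf.union (hf'.image _)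
  refine ⟨hfin.subset hsub, ?_⟩
  have h1 := Set.ncard_le_ncard hsub hfin
  have h2 := Set.ncard_union_le A ((1 - ·) '' B)
  have h3 := Set.ncard_image_le (f := (1 - · : ℂ → ℂ)) hf'
  have h4 : ({ρ : ℂ | 0 < ρ.re ∧ ρ.re < 1 ∧ |ρ.im| ≤ T ∧ LFunction χ ρ = 0}.ncard : ℝ) ≤
      A.ncard + B.ncard := by exact_mod_cast (by omega)
  refine h4.trans ((add_le_add hn hn').trans_eq (by ring))

lemma LFunction_primitiveCharacter_eq_zero {q : ℕ} [NeZero q] (χ : DirichletCharacter ℂ q)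
    [NeZero χ.conductor] {s : ℂ} (h0 : 0 < s.re) (h1 : s ≠ 1) (hs : LFunction χ s = 0) :
    LFunction χ.primitiveCharacter s = 0 := by
  rw [← χ.changeLevel_primitiveCharacter, LFunction_changeLevel _ _ (.inr h1)] at hs
  refine (mul_eq_zero.mp hs).resolve_right (Finset.prod_ne_zero_iff.mpr fun p hp h ↦ ?_)
  have hp1 : 1 < p := (Nat.prime_of_mem_primeFactors hp).one_lt
  have hlt : ‖χ.primitiveCharacter p * (p : ℂ) ^ (-s)‖ < 1 := by
    rw [norm_mul, norm_natCast_cpow_of_pos (by omega)]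
    have : (p : ℝ) ^ (-s).re < 1 :=
      Real.rpow_lt_one_of_one_lt_of_neg (by exact_mod_cast hp1) (by simpa)
    exact (mul_le_of_le_one_left (by positivity) (norm_le_one _ _)).trans_lt this
  rw [← sub_eq_zero.mp h] at hlt
  simp at hlt

end DirichletCharacter

end

theorem riemann_von_mangoldt_dirichlet :
    ∃ C : ℝ, 0 < C ∧ ∀ (q : ℕ) [NeZero q], 3 ≤ q → ∀ χ : DirichletCharacter ℂ q, ∀ T : ℝ, 1 ≤ T →
      {ρ : ℂ | 0 < ρ.re ∧ ρ.re < 1 ∧ |ρ.im| ≤ T ∧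
          DirichletCharacter.LFunction χ ρ = 0}.Finite ∧
      ({ρ : ℂ | 0 < ρ.re ∧ ρ.re < 1 ∧ |ρ.im| ≤ T ∧
          DirichletCharacter.LFunction χ ρ = 0}.ncard : ℝ) ≤ C * T * Real.log (q * T) := by
  refine ⟨50 / Real.log (35 / 32), div_pos (by norm_num) (Real.log_pos (by norm_num)), ?_⟩
  intro q _ hq χ T hT
  have : NeZero χ.conductor := ⟨χ.conductor_ne_zero⟩
  obtain ⟨hf, hn⟩ := χ.primitiveCharacter_isPrimitive.finite_zeros_LFunction_and_ncard_le hq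
    (Nat.le_of_dvd (by omega) χ.conductor_dvd_level) hT
  have hsub : {ρ : ℂ | 0 < ρ.re ∧ ρ.re < 1 ∧ |ρ.im| ≤ T ∧
      DirichletCharacter.LFunction χ ρ = 0} ⊆ {ρ : ℂ | 0 < ρ.re ∧ ρ.re < 1 ∧ |ρ.im| ≤ T ∧
      DirichletCharacter.LFunction χ.primitiveCharacter ρ = 0} := fun ρ ⟨h1, h2, h3, h4⟩ ↦
    ⟨h1, h2, h3, χ.LFunction_primitiveCharacter_eq_zero h1 (by rintro rfl; simp at h2) h4⟩
  exact ⟨hf.subset hsub, le_trans (by exact_mod_cast Set.ncard_le_ncard hsub hf) hn⟩
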